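/- arXiv:2508.07509 — 2 statements merged into one kernel-verified Lean document; each statement's English description precedes it below -/
import Mathlib

section
/- Height-preserving contraction for GT⁻: left contraction is height-preserving admissible: if Γ,ν,ν ⇒ Δ has a GT⁻-derivation of height at most n then so does Γ,ν ⇒ Δ, for any PL(∨∨) formula ν. Right contraction is height-preserving admissible for classical formulas: if Γ ⇒ α,α,Δ has a GT⁻-derivation of height at most n and α is classical, then Γ ⇒ α,Δ has a GT⁻-derivation of height at most n. -/
/-! Basic propositional team logic PL(∨∨): syntax, team semantics,
resolutions, and the sequent calculi GT, G3cp, GT'. -/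

/-- Valuations over a countably infinite set of propositional variables (ℕ). -/
abbrev Val : Type := ℕ → Bool

/-- A team is a set of valuations. -/
abbrev Team : Type := Set Val

/-- Formulas; PL(∨∨) formulas are the well-formed (`WF`) ones, in which
negation is applied only to classical formulas. `disj` is the split
disjunction ∨ and `idisj` the inquisitive disjunction ∨∨. -/
inductive Form : Type where
  | var : ℕ → Form
  | bot : Form
  | neg : Form → Form
  | conj : Form → Form → Form
  | disj : Form → Form → Form
  | idisj : Form → Form → Form

namespace Form

/-- Classical (CPL) formulas: no inquisitive disjunction. -/
def IsClassical : Form → Prop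
  | var _ => True
  | bot => True
  | neg α => IsClassical α
  | conj α β => IsClassical α ∧ IsClassical β
  | disj α β => IsClassical α ∧ IsClassical β
  | idisj _ _ => False

/-- Well-formed formulas = formulas of PL(∨∨): negation applies only to
classical formulas. -/
def WF : Form → Prop
  | var _ => True
  | bot => True
  | neg α => IsClassical α
  | conj φ ψ => WF φ ∧ WF ψ
  | disj φ ψ => WF φ ∧ WF ψ
  | idisj φ ψ => WF φ ∧ WF ψ

/-- Team satisfaction. -/
def Sat : Form → Team → Prop
  | var p, t => ∀ v ∈ t, v p = true
  | bot, t => t = ∅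
  | neg α, t => ∀ v ∈ t, ¬ Sat α {v}
  | conj φ ψ, t => Sat φ t ∧ Sat ψ t
  | disj φ ψ, t => ∃ s u : Team, t = s ∪ u ∧ Sat φ s ∧ Sat ψ u
  | idisj φ ψ, t => Sat φ t ∨ Sat ψ t

/-- Single-valuation (classical) satisfaction, for classical formulas. -/
def CSat : Form → Val → Prop
  | var p, v => v p = true
  | bot, _ => False
  | neg α, v => ¬ CSat α v
  | conj α β, v => CSat α v ∧ CSat β v
  | disj α β, v => CSat α v ∨ CSat β v
  | idisj _ _, _ => False

/-- The set of resolutions of a formula. -/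
def res : Form → Set Form
  | var p => {var p}
  | bot => {bot}
  | neg α => Form.neg '' res α
  | conj φ ψ => Set.image2 Form.conj (res φ) (res ψ)
  | disj φ ψ => Set.image2 Form.disj (res φ) (res ψ)
  | idisj φ ψ => res φ ∪ res ψ

/-- Propositional variables occurring in a formula. -/
def vars : Form → Set ℕ
  | var p => {p}
  | bot => ∅
  | neg α => vars α
  | conj φ ψ => vars φ ∪ vars ψ
  | disj φ ψ => vars φ ∪ vars ψ
  | idisj φ ψ => vars φ ∪ vars ψ

/-- Signed occurrences: `svars φ true` = positively occurring variables,
`svars φ false` = negatively occurring variables. -/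
def svars : Form → Bool → Set ℕ
  | var p, b => if b then {p} else ∅
  | bot, _ => ∅
  | neg α, b => svars α (!b)
  | conj φ ψ, b => svars φ b ∪ svars ψ b
  | disj φ ψ, b => svars φ b ∪ svars ψ b
  | idisj φ ψ, b => svars φ b ∪ svars ψ b

/-- Positively occurring variables P⁺(φ). -/
def pvars (φ : Form) : Set ℕ := φ.svars true

/-- Negatively occurring variables P⁻(φ). -/
def nvars (φ : Form) : Set ℕ := φ.svars false

end Form

/-- `t ⊨ Γ`: every formula of the multiset Γ is satisfied by `t`. -/
def SatAll (t : Team) (Γ : Multiset Form) : Prop := ∀ φ ∈ Γ, Form.Sat φ t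

/-- Team entailment Γ ⊨ φ. -/
def Entails (Γ : Multiset Form) (φ : Form) : Prop :=
  ∀ t : Team, SatAll t Γ → Form.Sat φ t

/-- Resolutions R(Γ) of a multiset of formulas: images of Γ under resolution
functions. -/
def mres (Γ : Multiset Form) : Set (Multiset Form) :=
  {Ξ | ∃ f : Form → Form, (∀ φ ∈ Γ, f φ ∈ Form.res φ) ∧ Ξ = Γ.map f}

/-- Variables occurring in a multiset of formulas. -/
def mvars (Γ : Multiset Form) : Set ℕ := {p | ∃ φ ∈ Γ, p ∈ Form.vars φ}

/-- P⁺(Γ). -/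
def mpvars (Γ : Multiset Form) : Set ℕ := {p | ∃ φ ∈ Γ, p ∈ Form.pvars φ}

/-- P⁻(Γ). -/
def mnvars (Γ : Multiset Form) : Set ℕ := {p | ∃ φ ∈ Γ, p ∈ Form.nvars φ}

/-- The split disjunction ⋁Δ of a multiset (⊥ for the empty multiset).
(Satisfaction is invariant under the order of the chosen list.) -/
noncomputable def bigVee (Δ : Multiset Form) : Form :=
  Δ.toList.foldr Form.disj Form.bot

/-- One-hole formula contexts in which the hole does not occur in the scope
of a negation; these represent the subformula occurrences to which the
deep-inference rules may be applied. -/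
inductive Ctx : Type where
  | hole : Ctx
  | conjL : Ctx → Form → Ctx
  | conjR : Form → Ctx → Ctx
  | disjL : Ctx → Form → Ctx
  | disjR : Form → Ctx → Ctx
  | idisjL : Ctx → Form → Ctx
  | idisjR : Form → Ctx → Ctx

/-- Plugging a formula into a context: χ{η}. -/
def Ctx.fill : Ctx → Form → Form
  | .hole, η => η
  | .conjL c ψ, η => Form.conj (c.fill η) ψ
  | .conjR ψ c, η => Form.conj ψ (c.fill η)
  | .disjL c ψ, η => Form.disj (c.fill η) ψ
  | .disjR ψ c, η => Form.disj ψ (c.fill η)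
  | .idisjL c ψ, η => Form.idisj (c.fill η) ψ
  | .idisjR ψ c, η => Form.idisj ψ (c.fill η)

/-- The sequent calculus GT. `GT c n Γ Δ` means: the sequent Γ ⇒ Δ has a
derivation of height at most `n`, using Cut only if `c = true`.
So `∃ n, GT true n Γ Δ` is derivability in GT, `∃ n, GT false n Γ Δ` is
derivability in the cut-free fragment GT⁻, and `GT false n Γ Δ` is
`⊢ⁿ Γ ⇒ Δ` (cut-free derivability with height at most n). -/
inductive GT : Bool → ℕ → Multiset Form → Multiset Form → Prop
  | ax (c : Bool) (n : ℕ) (Γ Δ : Multiset Form) (p : ℕ) :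
      GT c (n + 1) (Form.var p ::ₘ Γ) (Form.var p ::ₘ Δ)
  | lbot (c : Bool) (n : ℕ) (Γ Δ : Multiset Form) :
      GT c (n + 1) (Form.bot ::ₘ Γ) Δ
  | lneg (c : Bool) (n : ℕ) (Γ Δ : Multiset Form) (α : Form) :
      Form.IsClassical α → GT c n Γ (α ::ₘ Δ) →
      GT c (n + 1) (Form.neg α ::ₘ Γ) Δ
  | rneg (c : Bool) (n : ℕ) (Γ Δ : Multiset Form) (α : Form) :
      Form.IsClassical α → GT c n (α ::ₘ Γ) Δ →
      GT c (n + 1) Γ (Form.neg α ::ₘ Δ)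
  | lconj (c : Bool) (n : ℕ) (Γ Δ : Multiset Form) (φ ψ : Form) :
      GT c n (φ ::ₘ ψ ::ₘ Γ) Δ →
      GT c (n + 1) (Form.conj φ ψ ::ₘ Γ) Δ
  | rconj (c : Bool) (n : ℕ) (Γ Λ Δ : Multiset Form) (φ ψ : Form) :
      (∀ γ ∈ Λ, Form.IsClassical γ) →
      GT c n Γ (φ ::ₘ Λ) → GT c n Γ (ψ ::ₘ Λ) →
      GT c (n + 1) Γ (Form.conj φ ψ ::ₘ (Λ + Δ))
  | ldisj (c : Bool) (n : ℕ) (Γ Λ Δ : Multiset Form) (φ ψ : Form) :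
      (∀ γ ∈ Λ, Form.IsClassical γ) →
      GT c n (φ ::ₘ Γ) Λ → GT c n (ψ ::ₘ Γ) Λ →
      GT c (n + 1) (Form.disj φ ψ ::ₘ Γ) (Λ + Δ)
  | rdisj (c : Bool) (n : ℕ) (Γ Δ : Multiset Form) (φ ψ : Form) :
      GT c n Γ (φ ::ₘ ψ ::ₘ Δ) →
      GT c (n + 1) Γ (Form.disj φ ψ ::ₘ Δ)
  | lidisj (c : Bool) (n : ℕ) (Γ Δ : Multiset Form) (χ : Ctx) (φL φR : Form) :
      GT c n (χ.fill φL ::ₘ Γ) Δ → GT c n (χ.fill φR ::ₘ Γ) Δ →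
      GT c (n + 1) (χ.fill (Form.idisj φL φR) ::ₘ Γ) Δ
  | ridisjL (c : Bool) (n : ℕ) (Γ Δ : Multiset Form) (χ : Ctx) (φL φR : Form) :
      GT c n Γ (χ.fill φL ::ₘ Δ) →
      GT c (n + 1) Γ (χ.fill (Form.idisj φL φR) ::ₘ Δ)
  | ridisjR (c : Bool) (n : ℕ) (Γ Δ : Multiset Form) (χ : Ctx) (φL φR : Form) :
      GT c n Γ (χ.fill φR ::ₘ Δ) →
      GT c (n + 1) Γ (χ.fill (Form.idisj φL φR) ::ₘ Δ)
  | cut (n : ℕ) (Γ Δ Θ S : Multiset Form) (φ : Form) :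
      GT true n Γ (φ ::ₘ Δ) → GT true n (φ ::ₘ Θ) S →
      GT true (n + 1) (Γ + Θ) (Δ + S)

/-- The classical sequent calculus G3cp (on classical formulas).
`G3 false` is its cut-free fragment G3cp⁻. -/
inductive G3 : Bool → Multiset Form → Multiset Form → Prop
  | ax (c : Bool) (Γ Δ : Multiset Form) (p : ℕ) :
      (∀ α ∈ Γ, Form.IsClassical α) → (∀ α ∈ Δ, Form.IsClassical α) →
      G3 c (Form.var p ::ₘ Γ) (Form.var p ::ₘ Δ)
  | lbot (c : Bool) (Γ Δ : Multiset Form) :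
      (∀ α ∈ Γ, Form.IsClassical α) → (∀ α ∈ Δ, Form.IsClassical α) →
      G3 c (Form.bot ::ₘ Γ) Δ
  | lneg (c : Bool) (Γ Δ : Multiset Form) (α : Form) :
      Form.IsClassical α → G3 c Γ (α ::ₘ Δ) → G3 c (Form.neg α ::ₘ Γ) Δ
  | rneg (c : Bool) (Γ Δ : Multiset Form) (α : Form) :
      Form.IsClassical α → G3 c (α ::ₘ Γ) Δ → G3 c Γ (Form.neg α ::ₘ Δ)
  | lconj (c : Bool) (Γ Δ : Multiset Form) (α β : Form) :
      G3 c (α ::ₘ β ::ₘ Γ) Δ → G3 c (Form.conj α β ::ₘ Γ) Δ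
  | rconj (c : Bool) (Γ Λ Δ : Multiset Form) (α β : Form) :
      (∀ γ ∈ Λ, Form.IsClassical γ) → (∀ γ ∈ Δ, Form.IsClassical γ) →
      G3 c Γ (α ::ₘ Λ) → G3 c Γ (β ::ₘ Λ) →
      G3 c Γ (Form.conj α β ::ₘ (Λ + Δ))
  | ldisj (c : Bool) (Γ Λ Δ : Multiset Form) (α β : Form) :
      (∀ γ ∈ Λ, Form.IsClassical γ) → (∀ γ ∈ Δ, Form.IsClassical γ) →
      G3 c (α ::ₘ Γ) Λ → G3 c (β ::ₘ Γ) Λ →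
      G3 c (Form.disj α β ::ₘ Γ) (Λ + Δ)
  | rdisj (c : Bool) (Γ Δ : Multiset Form) (α β : Form) :
      G3 c Γ (α ::ₘ β ::ₘ Δ) → G3 c Γ (Form.disj α β ::ₘ Δ)
  | cut (Γ Δ Θ S : Multiset Form) (α : Form) :
      Form.IsClassical α →
      G3 true Γ (α ::ₘ Δ) → G3 true (α ::ₘ Θ) S →
      G3 true (Γ + Θ) (Δ + S)

/-- The cut-free variant calculus GT'⁻: GT⁻ with independent-context rules
R∧', L∨' in place of R∧, L∨, plus explicit contraction rules LC and RC
(RC restricted to classical formulas). -/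
inductive GTp : Multiset Form → Multiset Form → Prop
  | ax (Γ Δ : Multiset Form) (p : ℕ) :
      GTp (Form.var p ::ₘ Γ) (Form.var p ::ₘ Δ)
  | lbot (Γ Δ : Multiset Form) : GTp (Form.bot ::ₘ Γ) Δ
  | lneg (Γ Δ : Multiset Form) (α : Form) :
      Form.IsClassical α → GTp Γ (α ::ₘ Δ) → GTp (Form.neg α ::ₘ Γ) Δ
  | rneg (Γ Δ : Multiset Form) (α : Form) :
      Form.IsClassical α → GTp (α ::ₘ Γ) Δ → GTp Γ (Form.neg α ::ₘ Δ)
  | lconj (Γ Δ : Multiset Form) (φ ψ : Form) :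
      GTp (φ ::ₘ ψ ::ₘ Γ) Δ → GTp (Form.conj φ ψ ::ₘ Γ) Δ
  | rconj (Γ₁ Γ₂ Δ₁ Δ₂ : Multiset Form) (φ ψ : Form) :
      GTp Γ₁ (φ ::ₘ Δ₁) → GTp Γ₂ (ψ ::ₘ Δ₂) →
      GTp (Γ₁ + Γ₂) (Form.conj φ ψ ::ₘ (Δ₁ + Δ₂))
  | ldisj (Γ₁ Γ₂ Δ₁ Δ₂ : Multiset Form) (φ ψ : Form) :
      GTp (φ ::ₘ Γ₁) Δ₁ → GTp (ψ ::ₘ Γ₂) Δ₂ →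
      GTp (Form.disj φ ψ ::ₘ (Γ₁ + Γ₂)) (Δ₁ + Δ₂)
  | rdisj (Γ Δ : Multiset Form) (φ ψ : Form) :
      GTp Γ (φ ::ₘ ψ ::ₘ Δ) → GTp Γ (Form.disj φ ψ ::ₘ Δ)
  | lidisj (Γ Δ : Multiset Form) (χ : Ctx) (φL φR : Form) :
      GTp (χ.fill φL ::ₘ Γ) Δ → GTp (χ.fill φR ::ₘ Γ) Δ →
      GTp (χ.fill (Form.idisj φL φR) ::ₘ Γ) Δ
  | ridisjL (Γ Δ : Multiset Form) (χ : Ctx) (φL φR : Form) :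
      GTp Γ (χ.fill φL ::ₘ Δ) → GTp Γ (χ.fill (Form.idisj φL φR) ::ₘ Δ)
  | ridisjR (Γ Δ : Multiset Form) (χ : Ctx) (φL φR : Form) :
      GTp Γ (χ.fill φR ::ₘ Δ) → GTp Γ (χ.fill (Form.idisj φL φR) ::ₘ Δ)
  | lc (Γ Δ : Multiset Form) (φ : Form) :
      GTp (φ ::ₘ φ ::ₘ Γ) Δ → GTp (φ ::ₘ Γ) Δ
  | rc (Γ Δ : Multiset Form) (α : Form) :
      Form.IsClassical α → GTp Γ (α ::ₘ α ::ₘ Δ) → GTp Γ (α ::ₘ Δ)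

/-- `Split A B C`: the formulas `B` and `C` arise from `A` by replacing one occurrence of an
inquisitive disjunction, not in the scope of a negation, by its left and right disjunct. -/
inductive Split : Form → Form → Form → Prop
  | base (φ ψ : Form) : Split (.idisj φ ψ) φ ψ
  | conjL {A B C : Form} (φ : Form) : Split A B C → Split (.conj A φ) (.conj B φ) (.conj C φ)
  | conjR {A B C : Form} (φ : Form) : Split A B C → Split (.conj φ A) (.conj φ B) (.conj φ C)
  | disjL {A B C : Form} (φ : Form) : Split A B C → Split (.disj A φ) (.disj B φ) (.disj C φ)
  | disjR {A B C : Form} (φ : Form) : Split A B C → Split (.disj φ A) (.disj φ B) (.disj φ C)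
  | idisjL {A B C : Form} (φ : Form) : Split A B C → Split (.idisj A φ) (.idisj B φ) (.idisj C φ)
  | idisjR {A B C : Form} (φ : Form) : Split A B C → Split (.idisj φ A) (.idisj φ B) (.idisj φ C)

/-- `Pick A B`: `B` arises from `A` by replacing one such occurrence by one of its disjuncts. -/
inductive Pick : Form → Form → Prop
  | left (φ ψ : Form) : Pick (.idisj φ ψ) φ
  | right (φ ψ : Form) : Pick (.idisj φ ψ) ψ
  | conjL {A B : Form} (φ : Form) : Pick A B → Pick (.conj A φ) (.conj B φ)
  | conjR {A B : Form} (φ : Form) : Pick A B → Pick (.conj φ A) (.conj φ B)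
  | disjL {A B : Form} (φ : Form) : Pick A B → Pick (.disj A φ) (.disj B φ)
  | disjR {A B : Form} (φ : Form) : Pick A B → Pick (.disj φ A) (.disj φ B)
  | idisjL {A B : Form} (φ : Form) : Pick A B → Pick (.idisj A φ) (.idisj B φ)
  | idisjR {A B : Form} (φ : Form) : Pick A B → Pick (.idisj φ A) (.idisj φ B)

theorem split_fill (χ : Ctx) (φ ψ : Form) :
    Split (χ.fill (.idisj φ ψ)) (χ.fill φ) (χ.fill ψ) := by
  induction χ with
  | hole => exact .base _ _
  | conjL _ _ ih => exact .conjL _ ih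
  | conjR _ _ ih => exact .conjR _ ih
  | disjL _ _ ih => exact .disjL _ ih
  | disjR _ _ ih => exact .disjR _ ih
  | idisjL _ _ ih => exact .idisjL _ ih
  | idisjR _ _ ih => exact .idisjR _ ih

namespace Split

theorem exists_fill {A B C : Form} (h : Split A B C) :
    ∃ (χ : Ctx) (φ ψ : Form), A = χ.fill (.idisj φ ψ) ∧ B = χ.fill φ ∧ C = χ.fill ψ := by
  induction h with
  | base φ ψ => exact ⟨.hole, φ, ψ, rfl, rfl, rfl⟩
  | conjL φ _ ih => obtain ⟨χ, a, b, rfl, rfl, rfl⟩ := ih; exact ⟨.conjL χ φ, a, b, rfl, rfl, rfl⟩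
  | conjR φ _ ih => obtain ⟨χ, a, b, rfl, rfl, rfl⟩ := ih; exact ⟨.conjR φ χ, a, b, rfl, rfl, rfl⟩
  | disjL φ _ ih => obtain ⟨χ, a, b, rfl, rfl, rfl⟩ := ih; exact ⟨.disjL χ φ, a, b, rfl, rfl, rfl⟩
  | disjR φ _ ih => obtain ⟨χ, a, b, rfl, rfl, rfl⟩ := ih; exact ⟨.disjR φ χ, a, b, rfl, rfl, rfl⟩
  | idisjL φ _ ih =>
    obtain ⟨χ, a, b, rfl, rfl, rfl⟩ := ih; exact ⟨.idisjL χ φ, a, b, rfl, rfl, rfl⟩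
  | idisjR φ _ ih =>
    obtain ⟨χ, a, b, rfl, rfl, rfl⟩ := ih; exact ⟨.idisjR φ χ, a, b, rfl, rfl, rfl⟩

theorem not_isClassical {A B C : Form} (h : Split A B C) : ¬ A.IsClassical := by
  induction h <;> simp_all [Form.IsClassical]

theorem pick_left {A B C : Form} (h : Split A B C) : Pick A B := by
  induction h <;> constructor <;> assumption

theorem pick_right {A B C : Form} (h : Split A B C) : Pick A C := by
  induction h with
  | base => exact .right _ _
  | _ => constructor; assumption

/-- Confluence of choosing a disjunct and splitting at a possibly different occurrence. -/
theorem diamond {A B C X : Form} (h : Split A B C) (hX : Pick A X) :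
    (B = X ∨ Pick B X) ∨ (C = X ∨ Pick C X) ∨
      ∃ Y Z, Split X Y Z ∧ (B = Y ∨ Pick B Y) ∧ (C = Z ∨ Pick C Z) := by
  induction h generalizing X with
  | base φ ψ =>
    cases hX with
    | left => exact .inl (.inl rfl)
    | right => exact .inr (.inl (.inl rfl))
    | idisjL _ h => exact .inr (.inr ⟨_, _, .base _ _, .inr h, .inl rfl⟩)
    | idisjR _ h => exact .inr (.inr ⟨_, _, .base _ _, .inl rfl, .inr h⟩)
  | conjL φ h ih =>
    cases hX with
    | conjL _ hX =>
      rcases ih hX with (rfl | h) | (rfl | h) | ⟨Y, Z, hs, hB, hC⟩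
      · exact .inl (.inl rfl)
      · exact .inl (.inr (.conjL _ h))
      · exact .inr (.inl (.inl rfl))
      · exact .inr (.inl (.inr (.conjL _ h)))
      · exact .inr (.inr ⟨_, _, .conjL _ hs, hB.imp (congrArg (Form.conj · φ)) (.conjL _),
          hC.imp (congrArg (Form.conj · φ)) (.conjL _)⟩)
    | conjR _ hX => exact .inr (.inr ⟨_, _, .conjL _ h, .inr (.conjR _ hX), .inr (.conjR _ hX)⟩)
  | conjR φ h ih =>
    cases hX with
    | conjR _ hX =>
      rcases ih hX with (rfl | h) | (rfl | h) | ⟨Y, Z, hs, hB, hC⟩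
      · exact .inl (.inl rfl)
      · exact .inl (.inr (.conjR _ h))
      · exact .inr (.inl (.inl rfl))
      · exact .inr (.inl (.inr (.conjR _ h)))
      · exact .inr (.inr ⟨_, _, .conjR _ hs, hB.imp (congrArg (Form.conj φ)) (.conjR _),
          hC.imp (congrArg (Form.conj φ)) (.conjR _)⟩)
    | conjL _ hX => exact .inr (.inr ⟨_, _, .conjR _ h, .inr (.conjL _ hX), .inr (.conjL _ hX)⟩)
  | disjL φ h ih =>
    cases hX with
    | disjL _ hX =>
      rcases ih hX with (rfl | h) | (rfl | h) | ⟨Y, Z, hs, hB, hC⟩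
      · exact .inl (.inl rfl)
      · exact .inl (.inr (.disjL _ h))
      · exact .inr (.inl (.inl rfl))
      · exact .inr (.inl (.inr (.disjL _ h)))
      · exact .inr (.inr ⟨_, _, .disjL _ hs, hB.imp (congrArg (Form.disj · φ)) (.disjL _),
          hC.imp (congrArg (Form.disj · φ)) (.disjL _)⟩)
    | disjR _ hX => exact .inr (.inr ⟨_, _, .disjL _ h, .inr (.disjR _ hX), .inr (.disjR _ hX)⟩)
  | disjR φ h ih =>
    cases hX with
    | disjR _ hX =>
      rcases ih hX with (rfl | h) | (rfl | h) | ⟨Y, Z, hs, hB, hC⟩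
      · exact .inl (.inl rfl)
      · exact .inl (.inr (.disjR _ h))
      · exact .inr (.inl (.inl rfl))
      · exact .inr (.inl (.inr (.disjR _ h)))
      · exact .inr (.inr ⟨_, _, .disjR _ hs, hB.imp (congrArg (Form.disj φ)) (.disjR _),
          hC.imp (congrArg (Form.disj φ)) (.disjR _)⟩)
    | disjL _ hX => exact .inr (.inr ⟨_, _, .disjR _ h, .inr (.disjL _ hX), .inr (.disjL _ hX)⟩)
  | idisjL φ h ih =>
    cases hX with
    | left => exact .inr (.inr ⟨_, _, h, .inr (.left _ _), .inr (.left _ _)⟩)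
    | right => exact .inl (.inr (.right _ _))
    | idisjL _ hX =>
      rcases ih hX with (rfl | h) | (rfl | h) | ⟨Y, Z, hs, hB, hC⟩
      · exact .inl (.inl rfl)
      · exact .inl (.inr (.idisjL _ h))
      · exact .inr (.inl (.inl rfl))
      · exact .inr (.inl (.inr (.idisjL _ h)))
      · exact .inr (.inr ⟨_, _, .idisjL _ hs, hB.imp (congrArg (Form.idisj · φ)) (.idisjL _),
          hC.imp (congrArg (Form.idisj · φ)) (.idisjL _)⟩)
    | idisjR _ hX => exact .inr (.inr ⟨_, _, .idisjL _ h, .inr (.idisjR _ hX), .inr (.idisjR _ hX)⟩)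
  | idisjR φ h ih =>
    cases hX with
    | right => exact .inr (.inr ⟨_, _, h, .inr (.right _ _), .inr (.right _ _)⟩)
    | left => exact .inl (.inr (.left _ _))
    | idisjR _ hX =>
      rcases ih hX with (rfl | h) | (rfl | h) | ⟨Y, Z, hs, hB, hC⟩
      · exact .inl (.inl rfl)
      · exact .inl (.inr (.idisjR _ h))
      · exact .inr (.inl (.inl rfl))
      · exact .inr (.inl (.inr (.idisjR _ h)))
      · exact .inr (.inr ⟨_, _, .idisjR _ hs, hB.imp (congrArg (Form.idisj φ)) (.idisjR _),
          hC.imp (congrArg (Form.idisj φ)) (.idisjR _)⟩)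
    | idisjL _ hX => exact .inr (.inr ⟨_, _, .idisjR _ h, .inr (.idisjL _ hX), .inr (.idisjL _ hX)⟩)

end Split

/-- The cut-free rules without their contexts: `Rule P Q r ps` has principal part `P ⇒ Q` and
the sequents `ps` as active parts of the premises; `r` records whether the right context of the
premises has to be classical. -/
inductive Rule : Multiset Form → Multiset Form → Bool → List (Multiset Form × Multiset Form) → Prop
  | ax (p : ℕ) : Rule {.var p} {.var p} false []
  | lbot : Rule {.bot} 0 false []
  | lneg {α : Form} : α.IsClassical → Rule {.neg α} 0 false [(0, {α})]
  | rneg {α : Form} : α.IsClassical → Rule 0 {.neg α} false [({α}, 0)]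
  | lconj (φ ψ : Form) : Rule {.conj φ ψ} 0 false [({φ} + {ψ}, 0)]
  | rconj (φ ψ : Form) : Rule 0 {.conj φ ψ} true [(0, {φ}), (0, {ψ})]
  | ldisj (φ ψ : Form) : Rule {.disj φ ψ} 0 true [({φ}, 0), ({ψ}, 0)]
  | rdisj (φ ψ : Form) : Rule 0 {.disj φ ψ} false [(0, {φ} + {ψ})]
  | lidisj {A B C : Form} : Split A B C → Rule {A} 0 false [({B}, 0), ({C}, 0)]
  | ridisjL {A B C : Form} : Split A B C → Rule 0 {A} false [(0, {B})]
  | ridisjR {A B C : Form} : Split A B C → Rule 0 {A} false [(0, {C})]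

namespace GT

theorem of_eq {c : Bool} {n : ℕ} {Γ Γ' Δ Δ' : Multiset Form} (h : GT c n Γ Δ) (hΓ : Γ = Γ')
    (hΔ : Δ = Δ') : GT c n Γ' Δ' := hΓ ▸ hΔ ▸ h

/-- Height-preserving weakening. -/
theorem weaken {c : Bool} {n m : ℕ} {Γ Δ : Multiset Form} (h : GT c n Γ Δ) (hnm : n ≤ m)
    (L R : Multiset Form) : GT c m (Γ + L) (Δ + R) := by
  induction h generalizing m L R <;> obtain ⟨m, rfl⟩ : ∃ k, m = k + 1 := ⟨m - 1, by omega⟩ <;>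
    simp only [Multiset.cons_add, add_assoc] at *
  case ax => exact .ax _ _ _ _ _
  case lbot => exact .lbot _ _ _ _
  case lneg hα _ ih => exact .lneg _ _ _ _ _ hα (ih (by omega) _ _)
  case rneg hα _ ih => exact .rneg _ _ _ _ _ hα (ih (by omega) _ _)
  case lconj ih => exact .lconj _ _ _ _ _ _ (ih (by omega) _ _)
  case rconj hΛ _ _ ih₁ ih₂ =>
    exact .rconj _ _ _ _ _ _ _ hΛ (by simpa using ih₁ (by omega) L 0)
      (by simpa using ih₂ (by omega) L 0)
  case ldisj hΛ _ _ ih₁ ih₂ =>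
    exact .ldisj _ _ _ _ _ _ _ hΛ (by simpa using ih₁ (by omega) L 0)
      (by simpa using ih₂ (by omega) L 0)
  case rdisj ih => exact .rdisj _ _ _ _ _ _ (ih (by omega) _ _)
  case lidisj ih₁ ih₂ =>
    exact .lidisj _ _ _ _ _ _ _ (ih₁ (by omega) _ _) (ih₂ (by omega) _ _)
  case ridisjL ih => exact .ridisjL _ _ _ _ _ _ _ (ih (by omega) _ _)
  case ridisjR ih => exact .ridisjR _ _ _ _ _ _ _ (ih (by omega) _ _)
  case cut ih₁ ih₂ =>
    exact .cut _ _ _ _ _ _ (by simpa using ih₁ (by omega) 0 0) (ih₂ (by omega) _ _)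

theorem of_rule {n : ℕ} {P Q Γ Λ : Multiset Form} {r : Bool}
    {ps : List (Multiset Form × Multiset Form)} (h : Rule P Q r ps)
    (hΛ : r = true → ∀ γ ∈ Λ, γ.IsClassical)
    (hp : ∀ p ∈ ps, GT false n (p.1 + Γ) (p.2 + Λ)) (Δ : Multiset Form) :
    GT false (n + 1) (P + Γ) (Q + (Λ + Δ)) := by
  have hw : ∀ p ∈ ps, GT false n (p.1 + Γ) (p.2 + (Λ + Δ)) := fun p h =>
    ((hp p h).weaken le_rfl 0 Δ).of_eq (add_zero _) (add_assoc _ _ _)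
  cases h <;>
    simp only [List.forall_mem_cons, List.not_mem_nil, false_imp_iff, forall_const, and_true,
      zero_add, Multiset.cons_add, Multiset.singleton_add] at hp hw ⊢
  case ax => exact .ax _ _ _ _ _
  case lbot => exact .lbot _ _ _ _
  case lneg hα => exact .lneg _ _ _ _ _ hα hw
  case rneg hα => exact .rneg _ _ _ _ _ hα hw
  case lconj => exact .lconj _ _ _ _ _ _ hw
  case rconj => exact .rconj _ _ _ _ _ _ _ (hΛ rfl) hp.1 hp.2
  case ldisj => exact .ldisj _ _ _ _ _ _ _ (hΛ rfl) hp.1 hp.2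
  case rdisj => exact .rdisj _ _ _ _ _ _ hw
  case lidisj hs =>
    obtain ⟨χ, a, b, rfl, rfl, rfl⟩ := hs.exists_fill
    exact .lidisj _ _ _ _ _ _ _ hw.1 hw.2
  case ridisjL hs =>
    obtain ⟨χ, a, b, rfl, rfl, rfl⟩ := hs.exists_fill
    exact .ridisjL _ _ _ _ _ _ _ hw
  case ridisjR hs =>
    obtain ⟨χ, a, b, rfl, rfl, rfl⟩ := hs.exists_fill
    exact .ridisjR _ _ _ _ _ _ _ hw

theorem exists_rule {m : ℕ} {Γ Δ : Multiset Form} (h : GT false m Γ Δ) :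
    ∃ n P Q r ps Γ₀ Λ Δ₀, m = n + 1 ∧ Rule P Q r ps ∧ Γ = P + Γ₀ ∧ Δ = Q + (Λ + Δ₀) ∧
      (r = true → ∀ γ ∈ Λ, γ.IsClassical) ∧ ∀ p ∈ ps, GT false n (p.1 + Γ₀) (p.2 + Λ) := by
  cases h with
  | ax _ n Γ Δ p => exact ⟨n, _, _, _, _, Γ, Δ, 0, rfl, .ax p, by simp, by simp, by simp, by simp⟩
  | lbot _ n Γ => exact ⟨n, _, _, _, _, Γ, Δ, 0, rfl, .lbot, by simp, by simp, by simp, by simp⟩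
  | lneg _ n Γ _ α hα h =>
    exact ⟨n, _, _, _, _, Γ, Δ, 0, rfl, .lneg hα, by simp, by simp, by simp, by simpa⟩
  | rneg _ n _ Δ α hα h =>
    exact ⟨n, _, _, _, _, Γ, Δ, 0, rfl, .rneg hα, by simp, by simp, by simp, by simpa⟩
  | lconj _ n Γ _ φ ψ h =>
    exact ⟨n, _, _, _, _, Γ, Δ, 0, rfl, .lconj φ ψ, by simp, by simp, by simp,
      by simpa [add_assoc]⟩
  | rconj _ n _ Λ Δ φ ψ hΛ h₁ h₂ =>
    exact ⟨n, _, _, _, _, Γ, Λ, Δ, rfl, .rconj φ ψ, by simp, by simp, fun _ => hΛ,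
      by simpa using ⟨h₁, h₂⟩⟩
  | ldisj _ n Γ Λ Δ φ ψ hΛ h₁ h₂ =>
    exact ⟨n, _, _, _, _, Γ, Λ, Δ, rfl, .ldisj φ ψ, by simp, by simp, fun _ => hΛ,
      by simpa using ⟨h₁, h₂⟩⟩
  | rdisj _ n _ Δ φ ψ h =>
    exact ⟨n, _, _, _, _, Γ, Δ, 0, rfl, .rdisj φ ψ, by simp, by simp, by simp,
      by simpa [add_assoc]⟩
  | lidisj _ n Γ _ χ φ ψ h₁ h₂ =>
    exact ⟨n, _, _, _, _, Γ, Δ, 0, rfl, .lidisj (split_fill χ φ ψ), by simp, by simp, by simp,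
      by simpa using ⟨h₁, h₂⟩⟩
  | ridisjL _ n _ Δ χ φ ψ h =>
    exact ⟨n, _, _, _, _, Γ, Δ, 0, rfl, .ridisjL (split_fill χ φ ψ), by simp, by simp, by simp,
      by simpa⟩
  | ridisjR _ n _ Δ χ φ ψ h =>
    exact ⟨n, _, _, _, _, Γ, Δ, 0, rfl, .ridisjR (split_fill χ φ ψ), by simp, by simp, by simp,
      by simpa⟩

end GT

theorem Multiset.add_eq_singleton_add {α : Type*} {M N K : Multiset α} {a : α}
    (h : M + N = {a} + K) :
    (∃ M', M = {a} + M' ∧ K = M' + N) ∨ ∃ N', N = {a} + N' ∧ K = M + N' := by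
  have ha : a ∈ M + N := h ▸ Multiset.mem_add.2 (.inl (Multiset.mem_singleton_self a))
  rcases Multiset.mem_add.1 ha with ha | ha <;> obtain ⟨T, rfl⟩ := Multiset.exists_cons_of_mem ha
  · refine .inl ⟨T, by simp, ?_⟩
    rw [← Multiset.singleton_add, add_assoc] at h
    exact (add_left_cancel h).symm
  · refine .inr ⟨T, by simp, ?_⟩
    rw [← Multiset.singleton_add, add_left_comm] at h
    exact (add_left_cancel h).symm

theorem Multiset.add_eq_singleton_add_of_card_le_one {α : Type*} {P M K : Multiset α} {a : α}
    (hP : P.card ≤ 1) (h : P + M = {a} + K) :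
    (P = {a} ∧ M = K) ∨ ∃ M', M = {a} + M' ∧ K = P + M' := by
  rcases Multiset.add_eq_singleton_add h with ⟨P', rfl, rfl⟩ | h
  · have : P' = 0 := by simpa using hP
    subst this
    exact .inl ⟨by simp, by simp⟩
  · exact .inr h

/-- `LInv A L R`: from `A, Γ ⇒ Δ` one may pass to `L, Γ ⇒ R, Δ`. -/
inductive LInv : Form → Multiset Form → Multiset Form → Prop
  | neg {α : Form} : α.IsClassical → LInv (.neg α) 0 {α}
  | conj (φ ψ : Form) : LInv (.conj φ ψ) ({φ} + {ψ}) 0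
  | disjL (φ ψ : Form) : LInv (.disj φ ψ) {φ} 0
  | disjR (φ ψ : Form) : LInv (.disj φ ψ) {ψ} 0
  | pick {A B : Form} : Pick A B → LInv A {B} 0

/-- `RInv A L R`: from `Γ ⇒ A, Δ` one may pass to `L, Γ ⇒ R, Δ`. -/
inductive RInv : Form → Multiset Form → Multiset Form → Prop
  | neg {α : Form} : α.IsClassical → RInv (.neg α) {α} 0
  | conjL {α β : Form} : α.IsClassical → β.IsClassical → RInv (.conj α β) 0 {α}
  | conjR {α β : Form} : α.IsClassical → β.IsClassical → RInv (.conj α β) 0 {β}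
  | disj {α β : Form} : α.IsClassical → β.IsClassical → RInv (.disj α β) 0 ({α} + {β})

theorem LInv.isClassical {A : Form} {L R : Multiset Form} (h : LInv A L R) :
    ∀ γ ∈ R, γ.IsClassical := by
  cases h <;> simp_all

theorem RInv.isClassical {A : Form} {L R : Multiset Form} (h : RInv A L R) :
    ∀ γ ∈ R, γ.IsClassical := by
  cases h <;> simp_all

theorem RInv.isClassical_self {A : Form} {L R : Multiset Form} (h : RInv A L R) :
    A.IsClassical := by
  cases h <;> simp_all [Form.IsClassical]

namespace Rule

variable {P Q : Multiset Form} {r : Bool} {ps : List (Multiset Form × Multiset Form)}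

theorem card_left_le_one (h : Rule P Q r ps) : P.card ≤ 1 := by
  cases h <;> simp

theorem card_right_le_one (h : Rule P Q r ps) : Q.card ≤ 1 := by
  cases h <;> simp

theorem lInv (h : Rule P Q r ps) {A : Form} (hP : P = {A}) : ∀ p ∈ ps, LInv A p.1 p.2 := by
  cases h <;> simp only [Multiset.singleton_inj, List.forall_mem_cons, List.not_mem_nil,
    false_imp_iff, forall_const, and_true] at hP ⊢
  case lneg hα => exact hP ▸ .neg hα
  case lconj => exact hP ▸ .conj _ _
  case ldisj => exact hP ▸ ⟨.disjL _ _, .disjR _ _⟩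
  case lidisj hs => exact hP ▸ ⟨.pick hs.pick_left, .pick hs.pick_right⟩
  all_goals simp at hP

theorem rInv (h : Rule P Q r ps) {A : Form} (hA : A.IsClassical) (hQ : Q = {A}) :
    ∀ p ∈ ps, RInv A p.1 p.2 := by
  cases h <;> simp only [Multiset.singleton_inj, List.forall_mem_cons, List.not_mem_nil,
    false_imp_iff, forall_const, and_true] at hQ ⊢
  case rneg hα => exact hQ ▸ .neg hα
  case rconj => subst hQ; exact ⟨.conjL hA.1 hA.2, .conjR hA.1 hA.2⟩
  case rdisj => subst hQ; exact .disj hA.1 hA.2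
  case ridisjL hs => subst hQ; exact absurd hA hs.not_isClassical
  case ridisjR hs => subst hQ; exact absurd hA hs.not_isClassical
  all_goals simp at hQ

theorem mem_of_rInv (h : Rule P Q r ps) {A : Form} {L R : Multiset Form} (hA : RInv A L R)
    (hQ : Q = {A}) : (L, R) ∈ ps := by
  have hcl := hA.isClassical_self
  cases h <;> simp only [Multiset.singleton_inj, Multiset.zero_ne_singleton] at hQ <;> subst hQ
  case ridisjL hs => exact absurd hcl hs.not_isClassical
  case ridisjR hs => exact absurd hcl hs.not_isClassical
  all_goals cases hA <;> simp

end Rule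

theorem LInv.gt_of_rule {A : Form} {L R P Q Γ Λ Δ : Multiset Form} {r : Bool} {n : ℕ}
    {ps : List (Multiset Form × Multiset Form)} (hA : LInv A L R) (h : Rule P Q r ps)
    (hP : P = {A}) (hΛ : r = true → ∀ γ ∈ Λ, γ.IsClassical)
    (ih : ∀ {A L R}, LInv A L R → ∀ {Γ Δ}, GT false n ({A} + Γ) Δ → GT false n (L + Γ) (R + Δ))
    (hp : ∀ p ∈ ps, GT false n (p.1 + Γ) (p.2 + Λ)) :
    GT false (n + 1) (L + Γ) (R + (Q + (Λ + Δ))) := by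
  have key : ∀ {X Y : Form} {Γ Δ}, (X = Y ∨ Pick X Y) → GT false n ({X} + Γ) Δ →
      GT false n ({Y} + Γ) Δ := by
    rintro X Y Γ Δ (rfl | hs) h
    · exact h
    · simpa using ih (.pick hs) h
  cases h <;> simp only [Multiset.singleton_inj, List.forall_mem_cons, List.not_mem_nil,
    false_imp_iff, forall_const, and_true, zero_add] at hP hp ⊢
  case ax => subst hP; cases hA with | pick h => cases h
  case lbot => subst hP; cases hA with | pick h => cases h
  case lneg hα =>
    subst hP
    cases hA with
    | neg _ => exact (hp.weaken (Nat.le_succ n) 0 Δ).of_eq (by simp) (by abel)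
    | pick h => cases h
  case lconj φ ψ =>
    subst hP
    cases hA with
    | conj => exact (hp.weaken (Nat.le_succ n) 0 Δ).of_eq (by simp) (by simp)
    | pick h =>
      cases h with
      | @conjL _ B _ h =>
        refine (GT.of_rule (.lconj B ψ) (Λ := Λ) (by simp) ?_ Δ).of_eq rfl (by simp)
        simpa using (key (.inr h) (hp.of_eq (add_assoc _ _ _) rfl)).of_eq
          (Γ' := {B} + {ψ} + Γ) (by abel) rfl
      | @conjR _ B _ h =>
        refine (GT.of_rule (.lconj φ B) (Λ := Λ) (by simp) ?_ Δ).of_eq rfl (by simp)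
        simpa using (key (.inr h) (hp.of_eq (Γ' := {ψ} + ({φ} + Γ)) (by abel) rfl)).of_eq
          (Γ' := {φ} + {B} + Γ) (by abel) rfl
  case ldisj φ ψ =>
    subst hP
    cases hA with
    | disjL => exact (hp.1.weaken (Nat.le_succ n) 0 Δ).of_eq (by simp) (by simp)
    | disjR => exact (hp.2.weaken (Nat.le_succ n) 0 Δ).of_eq (by simp) (by simp)
    | pick h =>
      cases h with
      | @disjL _ B _ h =>
        refine (GT.of_rule (.ldisj B ψ) (Λ := Λ) hΛ ?_ Δ).of_eq rfl (by simp)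
        simpa using ⟨key (.inr h) hp.1, hp.2⟩
      | @disjR _ B _ h =>
        refine (GT.of_rule (.ldisj φ B) (Λ := Λ) hΛ ?_ Δ).of_eq rfl (by simp)
        simpa using ⟨hp.1, key (.inr h) hp.2⟩
  case lidisj B C hs =>
    subst hP
    cases hA with
    | neg => cases hs
    | conj φ ψ =>
      cases hs with
      | @conjL _ B C _ h =>
        refine (GT.of_rule (.lidisj h) (Γ := {ψ} + Γ) (Λ := Λ) (by simp) ?_ Δ).of_eq
          (by abel) (by simp)
        simpa using And.intro
          ((ih (.conj _ _) hp.1).of_eq (Γ' := {B} + ({ψ} + Γ)) (by abel) rfl)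
          ((ih (.conj _ _) hp.2).of_eq (Γ' := {C} + ({ψ} + Γ)) (by abel) rfl)
      | @conjR _ B C _ h =>
        refine (GT.of_rule (.lidisj h) (Γ := {φ} + Γ) (Λ := Λ) (by simp) ?_ Δ).of_eq
          (by abel) (by simp)
        simpa using And.intro
          ((ih (.conj _ _) hp.1).of_eq (Γ' := {B} + ({φ} + Γ)) (by abel) rfl)
          ((ih (.conj _ _) hp.2).of_eq (Γ' := {C} + ({φ} + Γ)) (by abel) rfl)
    | disjL φ ψ =>
      cases hs with
      | @disjL _ B C _ h =>
        refine (GT.of_rule (.lidisj h) (Λ := Λ) (by simp) ?_ Δ).of_eq rfl (by simp)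
        simpa using And.intro (ih (.disjL _ _) hp.1) (ih (.disjL _ _) hp.2)
      | disjR _ h =>
        exact ((ih (.disjL _ _) hp.1).weaken (Nat.le_succ n) 0 Δ).of_eq (by simp) (by simp)
    | disjR φ ψ =>
      cases hs with
      | @disjR _ B C _ h =>
        refine (GT.of_rule (.lidisj h) (Λ := Λ) (by simp) ?_ Δ).of_eq rfl (by simp)
        simpa using And.intro (ih (.disjR _ _) hp.1) (ih (.disjR _ _) hp.2)
      | disjL _ h =>
        exact ((ih (.disjR _ _) hp.1).weaken (Nat.le_succ n) 0 Δ).of_eq (by simp) (by simp)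
    | pick h =>
      rcases hs.diamond h with h | h | ⟨Y, Z, hs, hB, hC⟩
      · exact ((key h hp.1).weaken (Nat.le_succ n) 0 Δ).of_eq (by simp) (by simp)
      · exact ((key h hp.2).weaken (Nat.le_succ n) 0 Δ).of_eq (by simp) (by simp)
      · refine (GT.of_rule (.lidisj hs) (Λ := Λ) (by simp) ?_ Δ).of_eq rfl (by simp)
        simpa using And.intro (key hB hp.1) (key hC hp.2)
  all_goals simp at hP

/-- Height-preserving inversion on the left. -/
theorem LInv.gt {A : Form} {L R : Multiset Form} (hA : LInv A L R) {n : ℕ} {Γ Δ : Multiset Form}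
    (h : GT false n ({A} + Γ) Δ) : GT false n (L + Γ) (R + Δ) := by
  induction n generalizing A L R Γ Δ with
  | zero => obtain ⟨_, _, _, _, _, _, _, _, h, _⟩ := h.exists_rule; simp at h
  | succ n ih =>
    obtain ⟨_, P, Q, r, ps, Γ₀, Λ, Δ₀, hn, hr, hΓ, rfl, hΛ, hp⟩ := h.exists_rule
    obtain rfl := Nat.succ.inj hn
    rcases Multiset.add_eq_singleton_add_of_card_le_one hr.card_left_le_one hΓ.symm with
      ⟨hP, rfl⟩ | ⟨K, rfl, rfl⟩
    · exact hA.gt_of_rule hr hP hΛ (fun h _ _ h' => ih h h') hp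
    · refine (GT.of_rule hr (Γ := L + K) (Λ := R + Λ) ?_ (fun p h => ?_) Δ₀).of_eq (by abel)
        (by abel)
      · intro h γ hγ
        exact (Multiset.mem_add.1 hγ).elim (hA.isClassical γ) (hΛ h γ)
      · exact (ih hA ((hp p h).of_eq (add_left_comm _ _ _) rfl)).of_eq (by abel) (by abel)

/-- Height-preserving inversion on the right, for classical formulas. -/
theorem RInv.gt {A : Form} {L R : Multiset Form} (hA : RInv A L R) {n : ℕ} {Γ Δ : Multiset Form}
    (h : GT false n Γ ({A} + Δ)) : GT false n (L + Γ) (R + Δ) := by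
  induction n generalizing Γ Δ with
  | zero => obtain ⟨_, _, _, _, _, _, _, _, h, _⟩ := h.exists_rule; simp at h
  | succ n ih =>
    obtain ⟨_, P, Q, r, ps, Γ₀, Λ, Δ₀, hn, hr, rfl, hΔ, hΛ, hp⟩ := h.exists_rule
    obtain rfl := Nat.succ.inj hn
    rcases Multiset.add_eq_singleton_add_of_card_le_one hr.card_right_le_one hΔ.symm with
      ⟨rfl, rfl⟩ | ⟨K, hK, rfl⟩
    · exact ((hp _ (hr.mem_of_rInv hA rfl)).weaken (Nat.le_succ n) P Δ₀).of_eq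
        (by dsimp only; abel) (by dsimp only; abel)
    · rcases Multiset.add_eq_singleton_add hK with ⟨Λ', rfl, rfl⟩ | ⟨Δ', rfl, rfl⟩
      · refine (GT.of_rule hr (Γ := L + Γ₀) (Λ := R + Λ') ?_ (fun p h => ?_) Δ₀).of_eq (by abel)
          (by abel)
        · intro h γ hγ
          exact (Multiset.mem_add.1 hγ).elim (hA.isClassical γ)
            fun hγ => hΛ h γ (Multiset.mem_add.2 (.inr hγ))
        · exact (ih ((hp p h).of_eq rfl (add_left_comm _ _ _))).of_eq (by abel) (by abel)
      · exact ((GT.of_rule hr hΛ hp Δ').weaken le_rfl L R).of_eq (by abel) (by abel)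

/-- Contraction of a whole multiset from contraction of its elements. -/
theorem Multiset.contract {α : Type*} {C : Multiset α → Prop} {M : Multiset α}
    (hC : ∀ a ∈ M, ∀ N, C ({a} + ({a} + N)) → C ({a} + N)) (N : Multiset α)
    (h : C (M + (M + N))) : C (M + N) := by
  induction M using Multiset.induction_on generalizing N with
  | empty => simpa using h
  | cons a M ih =>
    rw [← Multiset.singleton_add] at h ⊢
    have h₁ : C ({a} + (M + (M + N))) :=
      hC a (Multiset.mem_cons_self a M) _ (by convert h using 1; abel)
    have h₂ : C (M + ({a} + N)) :=
      ih (fun b hb => hC b (Multiset.mem_cons_of_mem hb)) _ (by convert h₁ using 1; abel)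
    convert h₂ using 1
    abel

/-- Height-preserving contraction, on both sides simultaneously. -/
theorem GT.contract (n : ℕ) :
    (∀ {Γ Δ : Multiset Form} {ν : Form},
      GT false n ({ν} + ({ν} + Γ)) Δ → GT false n ({ν} + Γ) Δ) ∧
    (∀ {Γ Δ : Multiset Form} {α : Form}, α.IsClassical →
      GT false n Γ ({α} + ({α} + Δ)) → GT false n Γ ({α} + Δ)) := by
  induction n with
  | zero =>
    constructor
    · intro _ _ _ h
      obtain ⟨_, _, _, _, _, _, _, _, h, _⟩ := h.exists_rule
      simp at h
    · intro _ _ _ _ h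
      obtain ⟨_, _, _, _, _, _, _, _, h, _⟩ := h.exists_rule
      simp at h
  | succ n ih =>
    have both : ∀ {L R Γ Δ : Multiset Form}, (∀ γ ∈ R, γ.IsClassical) →
        GT false n (L + (L + Γ)) (R + (R + Δ)) → GT false n (L + Γ) (R + Δ) := by
      intro L R Γ Δ hR h
      exact Multiset.contract (C := (GT false n · _)) (fun _ _ _ => ih.1) _
        (Multiset.contract (C := (GT false n _ ·)) (fun a ha _ => ih.2 (hR a ha)) _ h)
    constructor
    · intro Γ Δ ν h
      obtain ⟨_, P, Q, r, ps, Γ₀, Λ, Δ₀, hn, hr, hΓ, rfl, hΛ, hp⟩ := h.exists_rule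
      obtain rfl := Nat.succ.inj hn
      rcases Multiset.add_eq_singleton_add_of_card_le_one hr.card_left_le_one hΓ.symm with
        ⟨rfl, rfl⟩ | ⟨K, rfl, hK⟩
      · refine GT.of_rule hr hΛ (fun p h => ?_) Δ₀
        have hi := hr.lInv rfl p h
        exact both hi.isClassical (hi.gt ((hp p h).of_eq (add_left_comm _ _ _) rfl))
      · rcases Multiset.add_eq_singleton_add_of_card_le_one hr.card_left_le_one hK.symm with
          ⟨rfl, rfl⟩ | ⟨K, rfl, rfl⟩
        · refine GT.of_rule hr hΛ (fun p h => ?_) Δ₀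
          have hi := hr.lInv rfl p h
          exact both hi.isClassical (hi.gt ((hp p h).of_eq (add_left_comm _ _ _) rfl))
        · refine (GT.of_rule hr (Γ := {ν} + K) hΛ (fun p h => ?_) Δ₀).of_eq (by abel) rfl
          exact (ih.1 ((hp p h).of_eq (by abel) rfl)).of_eq (add_left_comm _ _ _) rfl
    · intro Γ Δ α hα h
      obtain ⟨_, P, Q, r, ps, Γ₀, Λ, Δ₀, hn, hr, rfl, hΔ, hΛ, hp⟩ := h.exists_rule
      obtain rfl := Nat.succ.inj hn
      have hM : (Q = {α} ∧ Λ + Δ₀ = {α} + Δ) ∨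
          ∃ K, Λ + Δ₀ = {α} + ({α} + K) ∧ Δ = Q + K := by
        rcases Multiset.add_eq_singleton_add_of_card_le_one hr.card_right_le_one hΔ.symm with
          h | ⟨K, h₁, h₂⟩
        · exact .inl h
        · rcases Multiset.add_eq_singleton_add_of_card_le_one hr.card_right_le_one h₂.symm with
            ⟨rfl, rfl⟩ | ⟨K, rfl, rfl⟩
          · exact .inl ⟨rfl, h₁⟩
          · exact .inr ⟨K, h₁, rfl⟩
      rcases hM with ⟨rfl, hM⟩ | ⟨K, hM, rfl⟩
      · rcases Multiset.add_eq_singleton_add hM with ⟨Λ', rfl, rfl⟩ | ⟨Δ', rfl, rfl⟩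
        · refine GT.of_rule hr (fun h γ hγ => hΛ h γ (Multiset.mem_add.2 (.inr hγ)))
            (fun p h => ?_) Δ₀
          have hi := hr.rInv hα rfl p h
          exact both hi.isClassical (hi.gt ((hp p h).of_eq rfl (add_left_comm _ _ _)))
        · exact GT.of_rule hr hΛ hp Δ'
      · rcases Multiset.add_eq_singleton_add hM with ⟨Λ', rfl, hK⟩ | ⟨Δ', rfl, hK⟩
        · rcases Multiset.add_eq_singleton_add hK.symm with ⟨Λ'', rfl, rfl⟩ | ⟨Δ', rfl, rfl⟩
          · refine (GT.of_rule hr (Λ := {α} + Λ'')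
              (fun h γ hγ => hΛ h γ (Multiset.mem_add.2 (.inr hγ)))
              (fun p h => ?_) Δ₀).of_eq rfl (by abel)
            exact (ih.2 hα ((hp p h).of_eq rfl (by abel))).of_eq rfl (add_left_comm _ _ _)
          · exact (GT.of_rule hr hΛ hp Δ').of_eq rfl (by abel)
        · exact (GT.of_rule hr hΛ hp Δ').of_eq rfl (by rw [← hK, add_left_comm])

/-- Height-preserving contraction for GT⁻: left contraction
is height-preserving admissible for all PL(∨∨) formulas, right contraction
for classical formulas. -/
theorem hp_contraction :
    (∀ (n : ℕ) (Γ Δ : Multiset Form) (ν : Form),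
      (∀ φ ∈ Γ, Form.WF φ) → (∀ φ ∈ Δ, Form.WF φ) → ν.WF →
      GT false n (ν ::ₘ ν ::ₘ Γ) Δ → GT false n (ν ::ₘ Γ) Δ) ∧
    (∀ (n : ℕ) (Γ Δ : Multiset Form) (α : Form),
      (∀ φ ∈ Γ, Form.WF φ) → (∀ φ ∈ Δ, Form.WF φ) → Form.IsClassical α →
      GT false n Γ (α ::ₘ α ::ₘ Δ) → GT false n Γ (α ::ₘ Δ)) := by
  refine ⟨fun n Γ Δ ν _ _ _ h => ?_, fun n Γ Δ α _ _ hα h => ?_⟩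
  · simpa using (GT.contract n).1 (by simpa using h)
  · simpa using (GT.contract n).2 hα (by simpa using h)
end

section
/- Cutfree completeness of GT: for finite multisets Γ, Δ of PL(∨∨) formulas, if Γ ⊨ ⋁Δ then the sequent Γ ⇒ Δ is derivable in GT⁻ (the cut-free fragment of GT). -/
namespace Form

/-- The number of connectives of a formula. -/
def size : Form → ℕ
  | var _ => 0
  | bot => 0
  | neg α => size α + 1
  | conj φ ψ => size φ + size ψ + 1
  | disj φ ψ => size φ + size ψ + 1
  | idisj φ ψ => size φ + size ψ + 1

theorem sat_iff_forall_cSat {α : Form} (hα : IsClassical α) (t : Team) :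
    Sat α t ↔ ∀ v ∈ t, CSat α v := by
  induction α generalizing t with
  | var p => rfl
  | bot => simp [Sat, CSat, Set.eq_empty_iff_forall_notMem]
  | neg α ih => simp [Sat, CSat, ih hα]
  | conj α β ihα ihβ =>
    simp only [Sat, CSat, ihα hα.1, ihβ hα.2]
    grind
  | disj α β ihα ihβ =>
    simp only [Sat, CSat, ihα hα.1, ihβ hα.2]
    constructor
    · rintro ⟨s, u, rfl, hs, hu⟩ v (hv | hv)
      · exact .inl (hs v hv)
      · exact .inr (hu v hv)
    · intro h
      refine ⟨{v ∈ t | CSat α v}, {v ∈ t | CSat β v}, ?_, fun v hv => hv.2, fun v hv => hv.2⟩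
      ext v
      have := h v
      simp only [Set.mem_union, Set.mem_ofPred_eq]
      tauto
  | idisj => exact hα.elim

theorem exists_eq_fill_idisj {φ : Form} (hφ : WF φ) (hc : ¬ IsClassical φ) :
    ∃ (χ : Ctx) (φL φR : Form), φ = χ.fill (idisj φL φR) := by
  induction φ with
  | var p => exact (hc trivial).elim
  | bot => exact (hc trivial).elim
  | neg α => exact (hc hφ).elim
  | conj φ ψ ihφ ihψ =>
    by_cases h : IsClassical φ
    · obtain ⟨χ, a, b, rfl⟩ := ihψ hφ.2 fun h' => hc ⟨h, h'⟩
      exact ⟨.conjR φ χ, a, b, rfl⟩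
    · obtain ⟨χ, a, b, rfl⟩ := ihφ hφ.1 h
      exact ⟨.conjL χ ψ, a, b, rfl⟩
  | disj φ ψ ihφ ihψ =>
    by_cases h : IsClassical φ
    · obtain ⟨χ, a, b, rfl⟩ := ihψ hφ.2 fun h' => hc ⟨h, h'⟩
      exact ⟨.disjR φ χ, a, b, rfl⟩
    · obtain ⟨χ, a, b, rfl⟩ := ihφ hφ.1 h
      exact ⟨.disjL χ ψ, a, b, rfl⟩
  | idisj φ ψ => exact ⟨.hole, φ, ψ, rfl⟩

end Form

namespace Ctx

theorem sat_fill_idisj (χ : Ctx) (φ ψ : Form) (t : Team) :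
    (χ.fill (.idisj φ ψ)).Sat t ↔ (χ.fill φ).Sat t ∨ (χ.fill ψ).Sat t := by
  induction χ generalizing t with
  | hole => rfl
  | _ =>
    simp only [fill, Form.Sat, *]
    grind

theorem wf_of_wf_fill_idisj {χ : Ctx} {φ ψ : Form} (h : (χ.fill (.idisj φ ψ)).WF) :
    (χ.fill φ).WF ∧ (χ.fill ψ).WF := by
  induction χ with
  | hole => exact h
  | _ => simp_all [fill, Form.WF]

theorem size_fill_lt {φ ψ : Form} (χ : Ctx) (h : φ.size < ψ.size) :
    (χ.fill φ).size < (χ.fill ψ).size := by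
  induction χ with
  | hole => exact h
  | _ =>
    simp only [fill, Form.size]
    lia

end Ctx

theorem sat_foldr_disj_perm {l l' : List Form} (h : l.Perm l') (t : Team) :
    (l.foldr Form.disj Form.bot).Sat t ↔ (l'.foldr Form.disj Form.bot).Sat t := by
  induction h generalizing t with
  | nil => rfl
  | cons φ _ ih => simp only [List.foldr_cons, Form.Sat, ih]
  | swap φ ψ l =>
    have swap_of_sat (φ ψ : Form) (h : (Form.disj φ (.disj ψ (l.foldr .disj .bot))).Sat t) :
        (Form.disj ψ (.disj φ (l.foldr .disj .bot))).Sat t := by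
      obtain ⟨s, _, rfl, hs, u, w, rfl, hu, hw⟩ := h
      exact ⟨u, s ∪ w, Set.union_left_comm s u w, hu, s, w, rfl, hs, hw⟩
    exact ⟨swap_of_sat ψ φ, swap_of_sat φ ψ⟩
  | trans _ _ ih ih' => exact (ih t).trans (ih' t)

theorem sat_bigVee_cons (φ : Form) (Δ : Multiset Form) (t : Team) :
    (bigVee (φ ::ₘ Δ)).Sat t ↔ (Form.disj φ (bigVee Δ)).Sat t := by
  refine sat_foldr_disj_perm (l' := φ :: Δ.toList) ?_ t
  rw [← Multiset.coe_eq_coe, ← Multiset.cons_coe, Multiset.coe_toList, Multiset.coe_toList]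

theorem sat_bigVee_fill_idisj_cons (χ : Ctx) (φ ψ : Form) (Δ : Multiset Form) (t : Team) :
    (bigVee (χ.fill (.idisj φ ψ) ::ₘ Δ)).Sat t ↔
      (bigVee (χ.fill φ ::ₘ Δ)).Sat t ∨ (bigVee (χ.fill ψ ::ₘ Δ)).Sat t := by
  simp only [sat_bigVee_cons, Form.Sat, Ctx.sat_fill_idisj]
  grind

theorem exists_cSat_of_sat_bigVee {Δ : Multiset Form} (hΔ : ∀ φ ∈ Δ, Form.IsClassical φ)
    {t : Team} (h : (bigVee Δ).Sat t) {v : Val} (hv : v ∈ t) : ∃ φ ∈ Δ, φ.CSat v := by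
  induction Δ using Multiset.induction_on generalizing t with
  | empty =>
    rw [bigVee, Multiset.toList_zero] at h
    exact ((h : t = ∅) ▸ hv : v ∈ (∅ : Team)).elim
  | cons φ Δ ih =>
    rw [Multiset.forall_mem_cons] at hΔ
    obtain ⟨s, u, rfl, hs, hu⟩ := (sat_bigVee_cons φ Δ t).1 h
    obtain hv | hv := hv
    · exact ⟨φ, Multiset.mem_cons_self φ Δ, (Form.sat_iff_forall_cSat hΔ.1 s).1 hs v hv⟩
    · obtain ⟨ψ, hψ, hψv⟩ := ih hΔ.2 hu hv
      exact ⟨ψ, Multiset.mem_cons_of_mem hψ, hψv⟩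

namespace GT

theorem mono {c : Bool} {n m : ℕ} {Γ Δ : Multiset Form} (h : GT c n Γ Δ) (hnm : n ≤ m) :
    GT c m Γ Δ := by
  induction h generalizing m with
  | ax | lbot | lneg | rneg | lconj | rconj | ldisj | rdisj | lidisj | ridisjL | ridisjR =>
    obtain ⟨m, rfl⟩ : ∃ k, m = k + 1 := ⟨m - 1, by lia⟩
    first
    | exact ax _ _ _ _ _
    | exact lbot _ _ _ _
    | apply lneg <;> grind
    | apply rneg <;> grind
    | apply lconj; grind
    | apply rconj <;> grind
    | apply ldisj <;> grind
    | apply rdisj; grind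
    | apply lidisj <;> grind
    | apply ridisjL; grind
    | apply ridisjR; grind
  | cut n Γ Δ Θ S φ _ _ ih ih' =>
    obtain ⟨m, rfl⟩ : ∃ k, m = k + 1 := ⟨m - 1, by lia⟩
    exact cut m Γ Δ Θ S φ (ih (by lia)) (ih' (by lia))

/-- Two derivable sequents have derivations with a common height bound. -/
theorem exists_common_height {c : Bool} {Γ Δ Γ' Δ' : Multiset Form}
    (h : ∃ n, GT c n Γ Δ) (h' : ∃ n, GT c n Γ' Δ') : ∃ n, GT c n Γ Δ ∧ GT c n Γ' Δ' := by
  obtain ⟨n, h⟩ := h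
  obtain ⟨m, h'⟩ := h'
  exact ⟨max n m, h.mono (le_max_left n m), h'.mono (le_max_right n m)⟩

theorem exists_mem_cons {α : Type*} {p : α → Prop} {a : α} {s : Multiset α} :
    (∃ x ∈ a ::ₘ s, p x) ↔ p a ∨ ∃ x ∈ s, p x := by
  simp

/-- Cut-free completeness for atomic sequents. -/
theorem exists_of_atomic {Γ Δ : Multiset Form}
    (hΓ : ∀ φ ∈ Γ, φ = .bot ∨ ∃ p, φ = .var p) (hΔ : ∀ φ ∈ Δ, φ = .bot ∨ ∃ p, φ = .var p)
    (h : ∀ v, (∀ φ ∈ Γ, Form.CSat φ v) → ∃ φ ∈ Δ, Form.CSat φ v) :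
    ∃ n, GT false n Γ Δ := by
  classical
  by_cases hb : Form.bot ∈ Γ
  · obtain ⟨Γ, rfl⟩ := Multiset.exists_cons_of_mem hb
    exact ⟨1, lbot _ _ _ _⟩
  · obtain ⟨φ, hφ, hφv⟩ := h (fun p => decide (Form.var p ∈ Γ)) fun φ hφ => by
      obtain rfl | ⟨p, rfl⟩ := hΓ φ hφ
      · exact (hb hφ).elim
      · simpa [Form.CSat] using hφ
    obtain rfl | ⟨p, rfl⟩ := hΔ φ hφ
    · exact hφv.elim
    · have hp : Form.var p ∈ Γ := by simpa [Form.CSat] using hφv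
      obtain ⟨Γ, rfl⟩ := Multiset.exists_cons_of_mem hp
      obtain ⟨Δ, rfl⟩ := Multiset.exists_cons_of_mem hφ
      exact ⟨1, ax _ _ _ _ _⟩

/-- Cut-free completeness for classical sequents. -/
theorem exists_of_isClassical {Γ Δ : Multiset Form}
    (hΓ : ∀ φ ∈ Γ, Form.IsClassical φ) (hΔ : ∀ φ ∈ Δ, Form.IsClassical φ)
    (h : ∀ v, (∀ φ ∈ Γ, Form.CSat φ v) → ∃ φ ∈ Δ, Form.CSat φ v) :
    ∃ n, GT false n Γ Δ := by
  induction hk : (Γ.map Form.size).sum + (Δ.map Form.size).sum using Nat.strong_induction_on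
    generalizing Γ Δ with
  | _ k ih =>
  subst hk
  by_cases hΓa : ∀ φ ∈ Γ, φ = .bot ∨ ∃ p, φ = .var p
  · by_cases hΔa : ∀ φ ∈ Δ, φ = .bot ∨ ∃ p, φ = .var p
    · exact exists_of_atomic hΓa hΔa h
    push Not at hΔa
    obtain ⟨φ, hφ, hφb, hφv⟩ := hΔa
    obtain ⟨Δ, rfl⟩ := Multiset.exists_cons_of_mem hφ
    cases φ with
    | var p => exact (hφv p rfl).elim
    | bot => exact (hφb rfl).elim
    | neg α =>
      simp only [Multiset.forall_mem_cons, exists_mem_cons, Form.IsClassical,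
        Form.CSat] at hΔ h
      obtain ⟨n, hn⟩ := @ih _ (by simp only [Multiset.map_cons, Multiset.sum_cons, Form.size]; lia)
        (α ::ₘ Γ) Δ (by simp_all) hΔ.2
        (by simp only [Multiset.forall_mem_cons]; grind) rfl
      exact ⟨n + 1, rneg _ _ _ _ _ hΔ.1 hn⟩
    | conj α β =>
      simp only [Multiset.forall_mem_cons, exists_mem_cons, Form.IsClassical,
        Form.CSat] at hΔ h
      obtain ⟨n, hα, hβ⟩ := exists_common_height
        (@ih _ (by simp only [Multiset.map_cons, Multiset.sum_cons, Form.size]; lia)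
          Γ (α ::ₘ Δ) hΓ (by simp_all)
          (by simp only [exists_mem_cons]; grind) rfl)
        (@ih _ (by simp only [Multiset.map_cons, Multiset.sum_cons, Form.size]; lia)
          Γ (β ::ₘ Δ) hΓ (by simp_all)
          (by simp only [exists_mem_cons]; grind) rfl)
      exact ⟨n + 1, by simpa using rconj _ _ _ _ 0 _ _ hΔ.2 hα hβ⟩
    | disj α β =>
      simp only [Multiset.forall_mem_cons, exists_mem_cons, Form.IsClassical,
        Form.CSat] at hΔ h
      obtain ⟨n, hn⟩ := @ih _ (by simp only [Multiset.map_cons, Multiset.sum_cons, Form.size]; lia)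
        Γ (α ::ₘ β ::ₘ Δ) hΓ (by simp_all)
        (by simp only [exists_mem_cons]; grind) rfl
      exact ⟨n + 1, rdisj _ _ _ _ _ _ hn⟩
    | idisj => exact (hΔ _ hφ).elim
  · push Not at hΓa
    obtain ⟨φ, hφ, hφb, hφv⟩ := hΓa
    obtain ⟨Γ, rfl⟩ := Multiset.exists_cons_of_mem hφ
    cases φ with
    | var p => exact (hφv p rfl).elim
    | bot => exact (hφb rfl).elim
    | neg α =>
      simp only [Multiset.forall_mem_cons, Form.IsClassical, Form.CSat] at hΓ h
      obtain ⟨n, hn⟩ := @ih _ (by simp only [Multiset.map_cons, Multiset.sum_cons, Form.size]; lia)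
        Γ (α ::ₘ Δ) hΓ.2 (by simp_all)
        (by simp only [exists_mem_cons]; grind) rfl
      exact ⟨n + 1, lneg _ _ _ _ _ hΓ.1 hn⟩
    | conj α β =>
      simp only [Multiset.forall_mem_cons, Form.IsClassical, Form.CSat] at hΓ h
      obtain ⟨n, hn⟩ := @ih _ (by simp only [Multiset.map_cons, Multiset.sum_cons, Form.size]; lia)
        (α ::ₘ β ::ₘ Γ) Δ (by simp_all) hΔ
        (by simp only [Multiset.forall_mem_cons]; grind) rfl
      exact ⟨n + 1, lconj _ _ _ _ _ _ hn⟩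
    | disj α β =>
      simp only [Multiset.forall_mem_cons, Form.IsClassical, Form.CSat] at hΓ h
      obtain ⟨n, hα, hβ⟩ := exists_common_height
        (@ih _ (by simp only [Multiset.map_cons, Multiset.sum_cons, Form.size]; lia)
          (α ::ₘ Γ) Δ (by simp_all) hΔ
          (by simp only [Multiset.forall_mem_cons]; grind) rfl)
        (@ih _ (by simp only [Multiset.map_cons, Multiset.sum_cons, Form.size]; lia)
          (β ::ₘ Γ) Δ (by simp_all) hΔ
          (by simp only [Multiset.forall_mem_cons]; grind) rfl)
      exact ⟨n + 1, by simpa using ldisj _ _ _ _ 0 _ _ hΔ hα hβ⟩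
    | idisj => exact (hΓ _ hφ).elim

/-- Cut-free completeness for sequents with a classical antecedent: it is enough that the
largest team satisfying the antecedent satisfies the succedent. -/
theorem exists_of_isClassical_left {Γ Δ : Multiset Form}
    (hΓ : ∀ φ ∈ Γ, Form.IsClassical φ) (hΔ : ∀ φ ∈ Δ, Form.WF φ)
    (h : (bigVee Δ).Sat {v | ∀ φ ∈ Γ, Form.CSat φ v}) : ∃ n, GT false n Γ Δ := by
  induction hk : (Δ.map Form.size).sum using Nat.strong_induction_on generalizing Δ with
  | _ k ih =>
  subst hk
  by_cases hc : ∀ φ ∈ Δ, Form.IsClassical φ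
  · exact exists_of_isClassical hΓ hc fun v hv => exists_cSat_of_sat_bigVee hc h hv
  push Not at hc
  obtain ⟨φ, hφ, hφc⟩ := hc
  obtain ⟨χ, φL, φR, rfl⟩ := Form.exists_eq_fill_idisj (hΔ φ hφ) hφc
  obtain ⟨Δ, rfl⟩ := Multiset.exists_cons_of_mem hφ
  rw [Multiset.forall_mem_cons] at hΔ
  have hwf := Ctx.wf_of_wf_fill_idisj hΔ.1
  have hL := χ.size_fill_lt (φ := φL) (ψ := .idisj φL φR) (by simp only [Form.size]; lia)
  have hR := χ.size_fill_lt (φ := φR) (ψ := .idisj φL φR) (by simp only [Form.size]; lia)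
  obtain h | h := (sat_bigVee_fill_idisj_cons χ φL φR Δ _).1 h
  · obtain ⟨n, hn⟩ := @ih _ (by simpa using hL) (χ.fill φL ::ₘ Δ)
      (Multiset.forall_mem_cons.2 ⟨hwf.1, hΔ.2⟩) h rfl
    exact ⟨n + 1, ridisjL _ _ _ _ _ _ _ hn⟩
  · obtain ⟨n, hn⟩ := @ih _ (by simpa using hR) (χ.fill φR ::ₘ Δ)
      (Multiset.forall_mem_cons.2 ⟨hwf.2, hΔ.2⟩) h rfl
    exact ⟨n + 1, ridisjR _ _ _ _ _ _ _ hn⟩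

end GT

/-- Cutfree completeness of GT: if Γ ⊨ ⋁Δ for finite
multisets of PL(∨∨) formulas, then Γ ⇒ Δ is derivable in GT⁻. -/
theorem cutfree_completeness (Γ Δ : Multiset Form)
    (hΓ : ∀ φ ∈ Γ, Form.WF φ) (hΔ : ∀ φ ∈ Δ, Form.WF φ)
    (h : Entails Γ (bigVee Δ)) : ∃ n, GT false n Γ Δ := by
  induction hk : (Γ.map Form.size).sum using Nat.strong_induction_on generalizing Γ with
  | _ k ih =>
  subst hk
  by_cases hc : ∀ φ ∈ Γ, Form.IsClassical φ
  · exact GT.exists_of_isClassical_left hc hΔ <| h _ fun φ hφ =>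
      (Form.sat_iff_forall_cSat (hc φ hφ) _).2 fun v hv => hv φ hφ
  push Not at hc
  obtain ⟨φ, hφ, hφc⟩ := hc
  obtain ⟨χ, φL, φR, rfl⟩ := Form.exists_eq_fill_idisj (hΓ φ hφ) hφc
  obtain ⟨Γ, rfl⟩ := Multiset.exists_cons_of_mem hφ
  simp only [Entails, SatAll, Multiset.forall_mem_cons, Ctx.sat_fill_idisj] at hΓ h
  have hwf := Ctx.wf_of_wf_fill_idisj hΓ.1
  have hL := χ.size_fill_lt (φ := φL) (ψ := .idisj φL φR) (by simp only [Form.size]; lia)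
  have hR := χ.size_fill_lt (φ := φR) (ψ := .idisj φL φR) (by simp only [Form.size]; lia)
  obtain ⟨n, hnL, hnR⟩ := GT.exists_common_height
    (ih _ (by simpa using hL) (χ.fill φL ::ₘ Γ) (Multiset.forall_mem_cons.2 ⟨hwf.1, hΓ.2⟩)
      (fun t ht => have ht := Multiset.forall_mem_cons.1 ht; h t ⟨.inl ht.1, ht.2⟩) rfl)
    (ih _ (by simpa using hR) (χ.fill φR ::ₘ Γ) (Multiset.forall_mem_cons.2 ⟨hwf.2, hΓ.2⟩)
      (fun t ht => have ht := Multiset.forall_mem_cons.1 ht; h t ⟨.inr ht.1, ht.2⟩) rfl)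
  exact ⟨n + 1, .lidisj _ _ _ _ _ _ _ hnL hnR⟩
end
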